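/- arXiv:2307.09064 — 2 statements merged into one kernel-verified Lean document; each statement's English description precedes it below -/
import Mathlib

section
/- For every tree t ∈ Tree^∞(F, K ∪ {□}), the substitution map u ↦ t{□ ↜ u} from Tree^∞(F,K) to Tree^∞(F,K) is ω-continuous with respect to ⊑_T: it is monotone, and for every ω-chain (u_i)_{i∈ℕ} it satisfies t{□ ↜ ⊔_i u_i} = ⊔_i (t{□ ↜ u_i}). -/
abbrev Pos := List ℕ

inductive Label (F : Type) (K : Type) where
  | sym (f : F)
  | var (k : K)
  | loop

def Label.arity {F K : Type} (ar : F → ℕ) : Label F K → ℕ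
  | .sym f => ar f
  | .var _ => 0
  | .loop => 0

/-- A possibly-infinite tree, as a partial map from positions to labels. -/
abbrev PTree (F K : Type) := Pos → Option (Label F K)

def IsTree {F K : Type} (ar : F → ℕ) (t : PTree F K) : Prop :=
  t [] ≠ none ∧
  (∀ (p : Pos) (j : ℕ), t (p ++ [j]) ≠ none → t p ≠ none) ∧
  (∀ (p : Pos) (l : Label F K), t p = some l →
    ∀ j : ℕ, (t (p ++ [j]) ≠ none ↔ 1 ≤ j ∧ j ≤ Label.arity ar l))

def subtree {F K : Type} (t : PTree F K) (p : Pos) : PTree F K := fun q => t (p ++ q)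

def loopTree {F K : Type} : PTree F K := fun p => if p = [] then some Label.loop else none

/-- A relation `R` is compatible with the coinductive characterization of refinement. -/
def RefineCompat {F K : Type} (ar : F → ℕ) (R : PTree F K → PTree F K → Prop) : Prop :=
  ∀ t₁ t₂, R t₁ t₂ →
    t₁ = loopTree ∨
    ∃ l : Label F K, l ≠ Label.loop ∧ t₁ [] = some l ∧ t₂ [] = some l ∧
      ∀ i : ℕ, 1 ≤ i → i ≤ Label.arity ar l → R (subtree t₁ [i]) (subtree t₂ [i])

/-- The refinement relation `⊑_T`: the largest relation compatible with the
coinductive characterization. -/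
def Refine {F K : Type} (ar : F → ℕ) (t₁ t₂ : PTree F K) : Prop :=
  ∃ R, RefineCompat ar R ∧ R t₁ t₂

/-- `s` is the supremum (w.r.t. `⊑_T`) of the ω-chain `c` of possibly-infinite trees. -/
def IsSupTree {F K : Type} (ar : F → ℕ) (c : ℕ → PTree F K) (s : PTree F K) : Prop :=
  (∀ i, Refine ar (c i) s) ∧ ∀ u, IsTree ar u → (∀ i, Refine ar (c i) u) → Refine ar s u

/- Substitution of the tree `u` for every occurrence of the hole variable `z` in `t`
(the coinductively defined substitution operator, given pointwise). -/
open Classical in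
noncomputable def subst {F K : Type} (z : K) (t u : PTree F K) : PTree F K := fun p =>
  if h : ∃ q : Pos, q <+: p ∧ t q = some (Label.var z) then
    u (p.drop h.choose.length)
  else t p

theorem IsTree.subtree {F K : Type} {ar : F → ℕ} {t : PTree F K} (ht : IsTree ar t) {p : Pos}
    (hp : t p ≠ none) : IsTree ar (subtree t p) := by
  refine ⟨by simpa [_root_.subtree] using hp, fun q j h => ?_, fun q l h j => ?_⟩
  · exact ht.2.1 (p ++ q) j (by simpa [_root_.subtree] using h)
  · simpa [_root_.subtree] using ht.2.2 (p ++ q) l h j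

theorem IsTree.eq_none_of_arity_eq_zero {F K : Type} {ar : F → ℕ} {t : PTree F K}
    (ht : IsTree ar t) {q : Pos} {l : Label F K} (hq : t q = some l) (hl : l.arity ar = 0) {r : Pos}
    (hr : r ≠ []) : t (q ++ r) = none := by
  induction r using List.reverseRecOn with
  | nil => exact absurd rfl hr
  | append_singleton r j ih =>
    by_contra h
    by_cases hr' : r = []
    · subst hr'
      have := (ht.2.2 q l hq j).1 (by simpa using h)
      omega
    · exact ht.2.1 (q ++ r) j (by simpa using h) (ih hr')

theorem IsTree.eq_loopTree {F K : Type} {ar : F → ℕ} {t : PTree F K} (ht : IsTree ar t)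
    (h : t [] = some Label.loop) : t = loopTree := by
  funext p
  by_cases hp : p = []
  · simp [loopTree, hp, h]
  · simpa [loopTree, hp] using ht.eq_none_of_arity_eq_zero h rfl hp

/-- Every label of `t₁` other than `↺` occurs at the same position of `t₂`. -/
def LabelLE {F K : Type} (t₁ t₂ : PTree F K) : Prop :=
  ∀ p l, l ≠ Label.loop → t₁ p = some l → t₂ p = some l

theorem LabelLE.ne_none {F K : Type} {ar : F → ℕ} {t₁ t₂ : PTree F K} (h₁ : IsTree ar t₁)
    (h₂ : IsTree ar t₂) (h : LabelLE t₁ t₂) {p : Pos} (hp : t₁ p ≠ none) : t₂ p ≠ none := by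
  rcases List.eq_nil_or_concat p with rfl | ⟨q, j, rfl⟩
  · exact h₂.1
  · rw [List.concat_eq_append] at hp ⊢
    obtain ⟨l, hl⟩ := Option.ne_none_iff_exists'.1 (h₁.2.1 q j hp)
    have hj := (h₁.2.2 q l hl j).1 hp
    have hloop : l ≠ Label.loop := by
      rintro rfl
      simp only [Label.arity] at hj
      omega
    exact (h₂.2.2 q l (h q l hloop hl) j).2 hj

theorem Refine.labelLE {F K : Type} {ar : F → ℕ} {t₁ t₂ : PTree F K} (h₁ : IsTree ar t₁)
    (h : Refine ar t₁ t₂) : LabelLE t₁ t₂ := by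
  obtain ⟨R, hR, h⟩ := h
  intro p l hl hp
  induction p generalizing t₁ t₂ with
  | nil =>
    rcases hR _ _ h with rfl | ⟨l', -, e₁, e₂, -⟩
    · exact absurd (Option.some.inj hp).symm hl
    · rw [e₂, ← e₁, hp]
  | cons i q ih =>
    rcases hR _ _ h with rfl | ⟨l', -, e₁, -, hsub⟩
    · simp [loopTree] at hp
    · have hi : t₁ [i] ≠ none := by
        intro hi
        have key : ∀ r : Pos, t₁ (i :: r) = none := by
          intro r
          induction r using List.reverseRecOn with
          | nil => exact hi
          | append_singleton r j ihr =>
            by_contra hne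
            exact h₁.2.1 (i :: r) j hne ihr
        simp [key] at hp
      have hij := (h₁.2.2 [] l' e₁ i).1 hi
      exact ih (h₁.subtree hi) (hsub i hij.1 hij.2) hp

theorem LabelLE.refine {F K : Type} {ar : F → ℕ} {t₁ t₂ : PTree F K} (h₁ : IsTree ar t₁)
    (h₂ : IsTree ar t₂) (h : LabelLE t₁ t₂) : Refine ar t₁ t₂ := by
  refine ⟨fun a b => IsTree ar a ∧ IsTree ar b ∧ LabelLE a b, ?_, h₁, h₂, h⟩
  rintro a b ⟨ha, hb, hab⟩
  obtain ⟨l, hl⟩ := Option.ne_none_iff_exists'.1 ha.1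
  by_cases hloop : l = Label.loop
  · exact Or.inl (ha.eq_loopTree (hloop ▸ hl))
  · have hl' := hab [] l hloop hl
    exact Or.inr ⟨l, hloop, hl, hl', fun i hi hi' =>
      ⟨ha.subtree ((ha.2.2 [] l hl i).2 ⟨hi, hi'⟩), hb.subtree ((hb.2.2 [] l hl' i).2 ⟨hi, hi'⟩),
        fun p => hab (i :: p)⟩⟩

theorem subst_append_of_hole {F K : Type} {ar : F → ℕ} {z : K} {t : PTree F K} (ht : IsTree ar t)
    (u : PTree F K) {q : Pos} (hq : t q = some (Label.var z)) (r : Pos) :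
    subst z t u (q ++ r) = u r := by
  have h : ∃ q' : Pos, q' <+: q ++ r ∧ t q' = some (Label.var z) := ⟨q, List.prefix_append q r, hq⟩
  have unique : ∀ {a b : Pos}, t a = some (Label.var z) → t b = some (Label.var z) →
      a <+: b → a = b := by
    rintro a _ ha hb ⟨r, rfl⟩
    by_contra hne
    have := ht.eq_none_of_arity_eq_zero ha rfl (r := r) (by rintro rfl; simp at hne)
    simp [this] at hb
  have heq : h.choose = q := by
    rcases List.prefix_or_prefix_of_prefix h.choose_spec.1 (List.prefix_append q r) with h' | h'
    · exact unique h.choose_spec.2 hq h'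
    · exact (unique hq h.choose_spec.2 h').symm
  rw [subst, dif_pos h, heq, List.drop_left]

theorem subst_of_no_hole {F K : Type} {z : K} {t : PTree F K} (u : PTree F K) {p : Pos}
    (hp : ¬ ∃ q : Pos, q <+: p ∧ t q = some (Label.var z)) : subst z t u p = t p :=
  dif_neg hp

theorem subst_hole_ne_none {F K : Type} {ar : F → ℕ} {z : K} {t u : PTree F K} (ht : IsTree ar t)
    (hu : IsTree ar u) {q : Pos} (hq : t q = some (Label.var z)) : subst z t u q ≠ none := by
  simpa using (subst_append_of_hole ht u hq []).trans_ne hu.1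

theorem subst_concat_ne_none_iff {F K : Type} {ar : F → ℕ} {z : K} {t u : PTree F K}
    (ht : IsTree ar t) (hu : IsTree ar u) {p : Pos}
    (hp : ¬ ∃ q : Pos, q <+: p ∧ t q = some (Label.var z)) (j : ℕ) :
    subst z t u (p ++ [j]) ≠ none ↔ t (p ++ [j]) ≠ none := by
  by_cases hj : t (p ++ [j]) = some (Label.var z)
  · simp [hj, subst_hole_ne_none ht hu hj]
  · rw [subst_of_no_hole]
    rintro ⟨q, hq, hqz⟩
    rcases List.prefix_concat_iff.1 hq with rfl | hq
    · exact hj hqz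
    · exact hp ⟨q, hq, hqz⟩

theorem IsTree.subst {F K : Type} {ar : F → ℕ} {z : K} {t u : PTree F K} (ht : IsTree ar t)
    (hu : IsTree ar u) : IsTree ar (subst z t u) := by
  refine ⟨?_, fun p j h => ?_, fun p l h j => ?_⟩
  · by_cases h : t [] = some (Label.var z)
    · exact subst_hole_ne_none ht hu h
    · rw [subst_of_no_hole]
      · exact ht.1
      · rintro ⟨q, hq, hqz⟩
        exact h (List.prefix_nil.1 hq ▸ hqz)
  · by_cases hp : ∃ q : Pos, q <+: p ∧ t q = some (Label.var z)
    · obtain ⟨q, ⟨r, rfl⟩, hq⟩ := hp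
      rw [List.append_assoc, subst_append_of_hole ht u hq] at h
      rw [subst_append_of_hole ht u hq]
      exact hu.2.1 r j h
    · rw [subst_of_no_hole u hp]
      exact ht.2.1 p j ((subst_concat_ne_none_iff ht hu hp j).1 h)
  · by_cases hp : ∃ q : Pos, q <+: p ∧ t q = some (Label.var z)
    · obtain ⟨q, ⟨r, rfl⟩, hq⟩ := hp
      rw [subst_append_of_hole ht u hq] at h
      rw [List.append_assoc, subst_append_of_hole ht u hq]
      exact hu.2.2 r l h j
    · rw [subst_of_no_hole u hp] at h
      rw [subst_concat_ne_none_iff ht hu hp j]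
      exact ht.2.2 p l h j

theorem Refine.subst {F K : Type} {ar : F → ℕ} {z : K} {t u₁ u₂ : PTree F K} (ht : IsTree ar t)
    (h₁ : IsTree ar u₁) (h₂ : IsTree ar u₂) (h : Refine ar u₁ u₂) :
    Refine ar (subst z t u₁) (subst z t u₂) := by
  refine LabelLE.refine (ht.subst h₁) (ht.subst h₂) fun p l hl hp => ?_
  by_cases hole : ∃ q : Pos, q <+: p ∧ t q = some (Label.var z)
  · obtain ⟨q, ⟨r, rfl⟩, hq⟩ := hole
    rw [subst_append_of_hole ht _ hq] at hp ⊢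
    exact h.labelLE h₁ r l hl hp
  · rwa [subst_of_no_hole _ hole] at hp ⊢

theorem IsSupTree.subst {F K : Type} {ar : F → ℕ} {z : K} {t s : PTree F K} {c : ℕ → PTree F K}
    (ht : IsTree ar t) (hc : ∀ i, IsTree ar (c i)) (hs : IsTree ar s) (h : IsSupTree ar c s) :
    IsSupTree ar (fun i => subst z t (c i)) (subst z t s) := by
  refine ⟨fun i => (h.1 i).subst ht (hc i) hs, fun w hw hle => ?_⟩
  have hle' : ∀ i, LabelLE (_root_.subst z t (c i)) w := fun i => (hle i).labelLE (ht.subst (hc i))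
  refine LabelLE.refine (ht.subst hs) hw fun p l hl hp => ?_
  by_cases hole : ∃ q : Pos, q <+: p ∧ t q = some (Label.var z)
  · obtain ⟨q, ⟨r, rfl⟩, hq⟩ := hole
    rw [subst_append_of_hole ht _ hq] at hp
    have hwq : IsTree ar (subtree w q) :=
      hw.subtree ((hle' 0).ne_none (ht.subst (hc 0)) hw (subst_hole_ne_none ht (hc 0) hq))
    refine (h.2 _ hwq fun i => LabelLE.refine (hc i) hwq fun r' l' hl' hr' => ?_).labelLE hs r l hl hp
    exact hle' i (q ++ r') l' hl' (by rwa [subst_append_of_hole ht _ hq])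
  · refine hle' 0 p l hl ?_
    rwa [subst_of_no_hole _ hole] at hp ⊢

/-- For every tree `t ∈ Tree^∞(F, K ∪ {□})`, the substitution map `u ↦ t{□ ↜ u}` is a map
from `Tree^∞(F,K)` to `Tree^∞(F,K)` that is ω-continuous w.r.t. `⊑_T`: it is monotone and
maps the supremum of an ω-chain to the supremum of the image chain. -/
theorem subst_omegaContinuous {F K : Type} [Nonempty F] (ar : F → ℕ)
    (z : K) (t : PTree F K) (ht : IsTree ar t) :
    (∀ u : PTree F K, IsTree ar u → IsTree ar (subst z t u)) ∧
    (∀ u₁ u₂ : PTree F K, IsTree ar u₁ → IsTree ar u₂ → Refine ar u₁ u₂ →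
      Refine ar (subst z t u₁) (subst z t u₂)) ∧
    (∀ c : ℕ → PTree F K, (∀ i, IsTree ar (c i)) → (∀ i, Refine ar (c i) (c (i + 1))) →
      ∀ s : PTree F K, IsTree ar s → IsSupTree ar c s →
        IsSupTree ar (fun i => subst z t (c i)) (subst z t s)) := by
  exact ⟨fun _ hu => ht.subst hu, fun _ _ h₁ h₂ h => h.subst ht h₁ h₂,
    fun _ hc _ _ hs h => h.subst ht hc hs⟩
end

section
/- For any regular infinite-tree expression E ∈ RegExp^∞(F,K) over the program alphabet F, there exists an algebraic regular infinite-tree expression E' ∈ RegExp^∞(F^α,K) such that for every valuation γ : K → M and every procedure-summary vector ν ∈ Mⁿ, the interpretations agree: 𝓢𝓜_γ⟦E⟧(ν) = M_γ⟦E'⟧(ν). -/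
abbrev Prob : Type := Set.Icc (0 : ℝ) 1

/-- The order induced by a `combine` operation: `a ⊑ b ↔ ∃ d, a ⊕ d = b`. -/
def srle {M : Type} (add : M → M → M) (a b : M) : Prop := ∃ d, add a d = b

/-- `s` is the supremum of the ω-chain `c` with respect to the relation `le`. -/
def IsChainSup {M : Type} (le : M → M → Prop) (c : ℕ → M) (s : M) : Prop :=
  (∀ i, le (c i) s) ∧ ∀ u, (∀ i, le (c i) u) → le s u

/-- `f` is ω-continuous w.r.t. `le`: monotone and preserving suprema of ω-chains. -/
def IsOmegaCont {M : Type} (le : M → M → Prop) (f : M → M) : Prop :=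
  (∀ a b, le a b → le (f a) (f b)) ∧
  ∀ (c : ℕ → M) (s : M), (∀ i, le (c i) (c (i + 1))) → IsChainSup le c s →
    IsChainSup le (fun i => f (c i)) (f s)

/-- An ω-continuous pre-Markov algebra (ωPMA) over a set `L` of logical conditions:
an ω-continuous semiring `⟨M, ⊕, ⊗, 0, 1⟩` (with induced order `⊑`), together with
ω-continuous confluence operations `◃φ▹`, `⋄p`, `⌣`, where `◃φ▹` and `⋄p` distribute
over `⊕` componentwise. -/
structure OmegaPMA (L : Type) (M : Type) where
  add : M → M → M
  mul : M → M → M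
  zero : M
  one : M
  cond : L → M → M → M
  prob : Prob → M → M → M
  ndet : M → M → M
  add_assoc : ∀ a b c, add (add a b) c = add a (add b c)
  add_comm : ∀ a b, add a b = add b a
  add_zero : ∀ a, add a zero = a
  mul_assoc : ∀ a b c, mul (mul a b) c = mul a (mul b c)
  one_mul : ∀ a, mul one a = a
  mul_one : ∀ a, mul a one = a
  left_distrib : ∀ a b c, mul a (add b c) = add (mul a b) (mul a c)
  right_distrib : ∀ a b c, mul (add a b) c = add (mul a c) (mul b c)
  le_antisymm : ∀ a b, srle add a b → srle add b a → a = b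
  chain_sup : ∀ c : ℕ → M, (∀ i, srle add (c i) (c (i + 1))) →
    ∃ s, IsChainSup (srle add) c s
  add_cont_left : ∀ a, IsOmegaCont (srle add) fun x => add x a
  add_cont_right : ∀ a, IsOmegaCont (srle add) (add a)
  mul_cont_left : ∀ a, IsOmegaCont (srle add) fun x => mul x a
  mul_cont_right : ∀ a, IsOmegaCont (srle add) (mul a)
  cond_cont_left : ∀ φ a, IsOmegaCont (srle add) fun x => cond φ x a
  cond_cont_right : ∀ φ a, IsOmegaCont (srle add) (cond φ a)
  prob_cont_left : ∀ p a, IsOmegaCont (srle add) fun x => prob p x a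
  prob_cont_right : ∀ p a, IsOmegaCont (srle add) (prob p a)
  ndet_cont_left : ∀ a, IsOmegaCont (srle add) fun x => ndet x a
  ndet_cont_right : ∀ a, IsOmegaCont (srle add) (ndet a)
  cond_add : ∀ φ a b c d, cond φ (add a b) (add c d) = add (cond φ a c) (cond φ b d)
  prob_add : ∀ p a b c d, prob p (add a b) (add c d) = add (prob p a c) (prob p b d)

/-- The induced order `⊑` of an ωPMA. -/
def OmegaPMA.le {L M : Type} (P : OmegaPMA L M) : M → M → Prop := srle P.add

/-- Algebraic regular infinite-tree expressions over the alphabet `F^α`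
(constants `c ∈ M`, `seq[c]`, `call[X_i]`, the confluences, concatenation `++_z`,
and μ-binders). -/
inductive AExp (L : Type) (M : Type) (K : Type) (n : ℕ) where
  | const (c : M)
  | var (z : K)
  | seq (c : M) (E : AExp L M K n)
  | call (i : Fin n) (E : AExp L M K n)
  | cond (φ : L) (E₁ E₂ : AExp L M K n)
  | prob (p : Prob) (E₁ E₂ : AExp L M K n)
  | ndet (E₁ E₂ : AExp L M K n)
  | concat (z : K) (E₁ E₂ : AExp L M K n)
  | mu (z : K) (E : AExp L M K n)

/-- Free variables of an algebraic regular infinite-tree expression. -/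
def AExp.fv {L M K : Type} {n : ℕ} : AExp L M K n → Set K
  | .const _ => ∅
  | .var z => {z}
  | .seq _ E => E.fv
  | .call _ E => E.fv
  | .cond _ E₁ E₂ => E₁.fv ∪ E₂.fv
  | .prob _ E₁ E₂ => E₁.fv ∪ E₂.fv
  | .ndet E₁ E₂ => E₁.fv ∪ E₂.fv
  | .concat z E₁ E₂ => (E₁.fv \ {z}) ∪ E₂.fv
  | .mu z E => E.fv \ {z}

/-- The interpretation `M_γ⟦E⟧(ν)` of an algebraic regular infinite-tree expression in
an ωPMA, under valuation `γ` and procedure-summary vector `ν`; μ-binders are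
interpreted as least fixed points (starting from `0`, w.r.t. `⊑`). -/
inductive AInterp {L M K : Type} {n : ℕ} [DecidableEq K] (P : OmegaPMA L M) :
    AExp L M K n → (K → M) → (Fin n → M) → M → Prop where
  | const (γ : K → M) (ν : Fin n → M) (c : M) : AInterp P (.const c) γ ν c
  | var (γ : K → M) (ν : Fin n → M) (z : K) : AInterp P (.var z) γ ν (γ z)
  | seq (c : M) {E : AExp L M K n} {γ : K → M} {ν : Fin n → M} {v : M} :
      AInterp P E γ ν v → AInterp P (.seq c E) γ ν (P.mul c v)
  | call (i : Fin n) {E : AExp L M K n} {γ : K → M} {ν : Fin n → M} {v : M} :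
      AInterp P E γ ν v → AInterp P (.call i E) γ ν (P.mul (ν i) v)
  | cond (φ : L) {E₁ E₂ : AExp L M K n} {γ : K → M} {ν : Fin n → M} {v₁ v₂ : M} :
      AInterp P E₁ γ ν v₁ → AInterp P E₂ γ ν v₂ →
      AInterp P (.cond φ E₁ E₂) γ ν (P.cond φ v₁ v₂)
  | prob (p : Prob) {E₁ E₂ : AExp L M K n} {γ : K → M} {ν : Fin n → M} {v₁ v₂ : M} :
      AInterp P E₁ γ ν v₁ → AInterp P E₂ γ ν v₂ →
      AInterp P (.prob p E₁ E₂) γ ν (P.prob p v₁ v₂)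
  | ndet {E₁ E₂ : AExp L M K n} {γ : K → M} {ν : Fin n → M} {v₁ v₂ : M} :
      AInterp P E₁ γ ν v₁ → AInterp P E₂ γ ν v₂ →
      AInterp P (.ndet E₁ E₂) γ ν (P.ndet v₁ v₂)
  | concat (z : K) {E₁ E₂ : AExp L M K n} {γ : K → M} {ν : Fin n → M} {v₂ v : M} :
      AInterp P E₂ γ ν v₂ → AInterp P E₁ (Function.update γ z v₂) ν v →
      AInterp P (.concat z E₁ E₂) γ ν v
  | mu (z : K) {E : AExp L M K n} {γ : K → M} {ν : Fin n → M} (g : M → M) {v : M} :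
      (∀ θ, AInterp P E (Function.update γ z θ) ν (g θ)) →
      g v = v → (∀ w, g w = w → P.le v w) →
      AInterp P (.mu z E) γ ν v

/-- Linear algebraic regular infinite-tree expressions over the alphabet `F^α_lin`
(linear calls `call_lin[Y_i;c]`, plus `⊕(,)` and `⊖(,)`). -/
inductive LExp (L : Type) (M : Type) (K : Type) (n : ℕ) where
  | const (c : M)
  | var (z : K)
  | seq (c : M) (E : LExp L M K n)
  | callLin (i : Fin n) (c : M)
  | cond (φ : L) (E₁ E₂ : LExp L M K n)
  | prob (p : Prob) (E₁ E₂ : LExp L M K n)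
  | ndet (E₁ E₂ : LExp L M K n)
  | add (E₁ E₂ : LExp L M K n)
  | sub (E₁ E₂ : LExp L M K n)
  | concat (z : K) (E₁ E₂ : LExp L M K n)
  | mu (z : K) (E : LExp L M K n)

/-- All variables occurring in a linear expression. -/
def LExp.vars {L M K : Type} {n : ℕ} : LExp L M K n → Set K
  | .const _ => ∅
  | .var z => {z}
  | .seq _ E => E.vars
  | .callLin _ _ => ∅
  | .cond _ E₁ E₂ => E₁.vars ∪ E₂.vars
  | .prob _ E₁ E₂ => E₁.vars ∪ E₂.vars
  | .ndet E₁ E₂ => E₁.vars ∪ E₂.vars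
  | .add E₁ E₂ => E₁.vars ∪ E₂.vars
  | .sub E₁ E₂ => E₁.vars ∪ E₂.vars
  | .concat z E₁ E₂ => insert z (E₁.vars ∪ E₂.vars)
  | .mu z E => insert z E.vars

/-- The interpretation `M_γ⟦E⟧(ν)` of a linear regular infinite-tree expression in an
ωPMA (the `⊖` symbol denotes any element `d` with `b ⊕ d = a`). -/
inductive LInterp {L M K : Type} {n : ℕ} [DecidableEq K] (P : OmegaPMA L M) :
    LExp L M K n → (K → M) → (Fin n → M) → M → Prop where
  | const (γ : K → M) (ν : Fin n → M) (c : M) : LInterp P (.const c) γ ν c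
  | var (γ : K → M) (ν : Fin n → M) (z : K) : LInterp P (.var z) γ ν (γ z)
  | seq (c : M) {E : LExp L M K n} {γ : K → M} {ν : Fin n → M} {v : M} :
      LInterp P E γ ν v → LInterp P (.seq c E) γ ν (P.mul c v)
  | callLin (γ : K → M) (ν : Fin n → M) (i : Fin n) (c : M) :
      LInterp P (.callLin i c) γ ν (P.mul (ν i) c)
  | cond (φ : L) {E₁ E₂ : LExp L M K n} {γ : K → M} {ν : Fin n → M} {v₁ v₂ : M} :
      LInterp P E₁ γ ν v₁ → LInterp P E₂ γ ν v₂ →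
      LInterp P (.cond φ E₁ E₂) γ ν (P.cond φ v₁ v₂)
  | prob (p : Prob) {E₁ E₂ : LExp L M K n} {γ : K → M} {ν : Fin n → M} {v₁ v₂ : M} :
      LInterp P E₁ γ ν v₁ → LInterp P E₂ γ ν v₂ →
      LInterp P (.prob p E₁ E₂) γ ν (P.prob p v₁ v₂)
  | ndet {E₁ E₂ : LExp L M K n} {γ : K → M} {ν : Fin n → M} {v₁ v₂ : M} :
      LInterp P E₁ γ ν v₁ → LInterp P E₂ γ ν v₂ →
      LInterp P (.ndet E₁ E₂) γ ν (P.ndet v₁ v₂)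
  | add {E₁ E₂ : LExp L M K n} {γ : K → M} {ν : Fin n → M} {v₁ v₂ : M} :
      LInterp P E₁ γ ν v₁ → LInterp P E₂ γ ν v₂ →
      LInterp P (.add E₁ E₂) γ ν (P.add v₁ v₂)
  | sub {E₁ E₂ : LExp L M K n} {γ : K → M} {ν : Fin n → M} {v₁ v₂ d : M} :
      LInterp P E₁ γ ν v₁ → LInterp P E₂ γ ν v₂ → P.add v₂ d = v₁ →
      LInterp P (.sub E₁ E₂) γ ν d
  | concat (z : K) {E₁ E₂ : LExp L M K n} {γ : K → M} {ν : Fin n → M} {v₂ v : M} :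
      LInterp P E₂ γ ν v₂ → LInterp P E₁ (Function.update γ z v₂) ν v →
      LInterp P (.concat z E₁ E₂) γ ν v
  | mu (z : K) {E : LExp L M K n} {γ : K → M} {ν : Fin n → M} (g : M → M) {v : M} :
      (∀ θ, LInterp P E (Function.update γ z θ) ν (g θ)) →
      g v = v → (∀ w, g w = w → P.le v w) →
      LInterp P (.mu z E) γ ν v

/-- The differential `D_{X_j} f_γ|_ν(Y)` of an algebraic regular infinite-tree
expression with respect to procedure `X_j` at `ν` under valuation `γ`. -/
inductive Diff {L M K : Type} {n : ℕ} [DecidableEq K] (P : OmegaPMA L M) (j : Fin n) :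
    AExp L M K n → (K → M) → (Fin n → M) → LExp L M K n → Prop where
  | const {γ : K → M} {ν : Fin n → M} (c : M) :
      Diff P j (.const c) γ ν (.const P.zero)
  | seq (c : M) {g : AExp L M K n} {γ : K → M} {ν : Fin n → M} {g' : LExp L M K n} :
      Diff P j g γ ν g' → Diff P j (.seq c g) γ ν (.seq c g')
  | call_ne (k : Fin n) (hk : k ≠ j) {g : AExp L M K n} {γ : K → M} {ν : Fin n → M}
      {g' : LExp L M K n} :
      Diff P j g γ ν g' → Diff P j (.call k g) γ ν (.seq (ν k) g')
  | call_eq {g : AExp L M K n} {γ : K → M} {ν : Fin n → M} {g' : LExp L M K n} {a : M} :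
      AInterp P g γ ν a → Diff P j g γ ν g' →
      Diff P j (.call j g) γ ν (.add (.callLin j a) (.seq (ν j) g'))
  | cond (φ : L) {g h : AExp L M K n} {γ : K → M} {ν : Fin n → M}
      {g' h' : LExp L M K n} :
      Diff P j g γ ν g' → Diff P j h γ ν h' →
      Diff P j (.cond φ g h) γ ν (.cond φ g' h')
  | prob (p : Prob) {g h : AExp L M K n} {γ : K → M} {ν : Fin n → M}
      {g' h' : LExp L M K n} :
      Diff P j g γ ν g' → Diff P j h γ ν h' →
      Diff P j (.prob p g h) γ ν (.prob p g' h')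
  | ndet {g h : AExp L M K n} {γ : K → M} {ν : Fin n → M} {g' h' : LExp L M K n}
      {a b c : M} :
      AInterp P g γ ν a → AInterp P h γ ν b → AInterp P (.ndet g h) γ ν c →
      Diff P j g γ ν g' → Diff P j h γ ν h' →
      Diff P j (.ndet g h) γ ν
        (.sub (.ndet (.add (.const a) g') (.add (.const b) h')) (.const c))
  | var {γ : K → M} {ν : Fin n → M} (z : K) : Diff P j (.var z) γ ν (.var z)
  | concat (z : K) {g h : AExp L M K n} {γ : K → M} {ν : Fin n → M}
      {g' h' : LExp L M K n} {b : M} :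
      AInterp P h γ ν b → Diff P j g (Function.update γ z b) ν g' →
      Diff P j h γ ν h' →
      Diff P j (.concat z g h) γ ν (.concat z g' h')
  | mu (z : K) {g : AExp L M K n} {γ : K → M} {ν : Fin n → M} {g' : LExp L M K n}
      {a : M} :
      AInterp P (.mu z g) γ ν a → Diff P j g (Function.update γ z a) ν g' →
      Diff P j (.mu z g) γ ν (.mu z g')

/-- `⊕`-fold of the components of a vector of linear expressions. -/
def foldAddL {L M K : Type} {n m : ℕ} (P : OmegaPMA L M) (d : Fin m → LExp L M K n) :
    LExp L M K n :=
  match List.ofFn d with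
  | [] => .const P.zero
  | x :: xs => xs.foldl .add x

/-- The multivariate differential `D f_γ|_ν(Y) = D_{X_1} f_γ|_ν(Y) ⊕ ⋯ ⊕ D_{X_n} f_γ|_ν(Y)`. -/
def DiffAll {L M K : Type} {n : ℕ} [DecidableEq K] (P : OmegaPMA L M)
    (f : AExp L M K n) (γ : K → M) (ν : Fin n → M) (E' : LExp L M K n) : Prop :=
  ∃ d : Fin n → LExp L M K n, (∀ j, Diff P j f γ ν (d j)) ∧ E' = foldAddL P d

/-- Regular infinite-tree expressions over the program alphabet `F` (data actions,
conditions, probabilistic and nondeterministic choice, and procedure calls). -/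
inductive PExp (A : Type) (L : Type) (K : Type) (n : ℕ) where
  | eps
  | var (z : K)
  | seq (act : A) (E : PExp A L K n)
  | call (i : Fin n) (E : PExp A L K n)
  | cond (φ : L) (E₁ E₂ : PExp A L K n)
  | prob (p : Prob) (E₁ E₂ : PExp A L K n)
  | ndet (E₁ E₂ : PExp A L K n)
  | concat (z : K) (E₁ E₂ : PExp A L K n)
  | mu (z : K) (E : PExp A L K n)

/-- Free variables of a program regular infinite-tree expression. -/
def PExp.fv {A L K : Type} {n : ℕ} : PExp A L K n → Set K
  | .eps => ∅
  | .var z => {z}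
  | .seq _ E => E.fv
  | .call _ E => E.fv
  | .cond _ E₁ E₂ => E₁.fv ∪ E₂.fv
  | .prob _ E₁ E₂ => E₁.fv ∪ E₂.fv
  | .ndet E₁ E₂ => E₁.fv ∪ E₂.fv
  | .concat z E₁ E₂ => (E₁.fv \ {z}) ∪ E₂.fv
  | .mu z E => E.fv \ {z}

/-- The interpretation `𝓢𝓜_γ⟦E⟧(ν)` of a program regular infinite-tree expression in
an ωPMA interpretation `(P, ia)`, under valuation `γ` and procedure-summary vector `ν`. -/
inductive PInterp {A L M K : Type} {n : ℕ} [DecidableEq K] (P : OmegaPMA L M)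
    (ia : A → M) : PExp A L K n → (K → M) → (Fin n → M) → M → Prop where
  | eps (γ : K → M) (ν : Fin n → M) : PInterp P ia .eps γ ν P.one
  | var (γ : K → M) (ν : Fin n → M) (z : K) : PInterp P ia (.var z) γ ν (γ z)
  | seq (act : A) {E : PExp A L K n} {γ : K → M} {ν : Fin n → M} {v : M} :
      PInterp P ia E γ ν v → PInterp P ia (.seq act E) γ ν (P.mul (ia act) v)
  | call (i : Fin n) {E : PExp A L K n} {γ : K → M} {ν : Fin n → M} {v : M} :
      PInterp P ia E γ ν v → PInterp P ia (.call i E) γ ν (P.mul (ν i) v)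
  | cond (φ : L) {E₁ E₂ : PExp A L K n} {γ : K → M} {ν : Fin n → M} {v₁ v₂ : M} :
      PInterp P ia E₁ γ ν v₁ → PInterp P ia E₂ γ ν v₂ →
      PInterp P ia (.cond φ E₁ E₂) γ ν (P.cond φ v₁ v₂)
  | prob (p : Prob) {E₁ E₂ : PExp A L K n} {γ : K → M} {ν : Fin n → M} {v₁ v₂ : M} :
      PInterp P ia E₁ γ ν v₁ → PInterp P ia E₂ γ ν v₂ →
      PInterp P ia (.prob p E₁ E₂) γ ν (P.prob p v₁ v₂)
  | ndet {E₁ E₂ : PExp A L K n} {γ : K → M} {ν : Fin n → M} {v₁ v₂ : M} :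
      PInterp P ia E₁ γ ν v₁ → PInterp P ia E₂ γ ν v₂ →
      PInterp P ia (.ndet E₁ E₂) γ ν (P.ndet v₁ v₂)
  | concat (z : K) {E₁ E₂ : PExp A L K n} {γ : K → M} {ν : Fin n → M} {v₂ v : M} :
      PInterp P ia E₂ γ ν v₂ → PInterp P ia E₁ (Function.update γ z v₂) ν v →
      PInterp P ia (.concat z E₁ E₂) γ ν v
  | mu (z : K) {E : PExp A L K n} {γ : K → M} {ν : Fin n → M} (g : M → M) {v : M} :
      (∀ θ, PInterp P ia E (Function.update γ z θ) ν (g θ)) →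
      g v = v → (∀ w, g w = w → P.le v w) →
      PInterp P ia (.mu z E) γ ν v

/-- The algebraic expression obtained from a program expression by replacing `ε` with the
constant `1` and every data action with its interpretation. -/
def PExp.toAExp {A L M K : Type} {n : ℕ} (P : OmegaPMA L M) (ia : A → M) :
    PExp A L K n → AExp L M K n
  | .eps => .const P.one
  | .var z => .var z
  | .seq act E => .seq (ia act) (E.toAExp P ia)
  | .call i E => .call i (E.toAExp P ia)
  | .cond φ E₁ E₂ => .cond φ (E₁.toAExp P ia) (E₂.toAExp P ia)
  | .prob p E₁ E₂ => .prob p (E₁.toAExp P ia) (E₂.toAExp P ia)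
  | .ndet E₁ E₂ => .ndet (E₁.toAExp P ia) (E₂.toAExp P ia)
  | .concat z E₁ E₂ => .concat z (E₁.toAExp P ia) (E₂.toAExp P ia)
  | .mu z E => .mu z (E.toAExp P ia)

theorem PInterp.toAExp {A L M K : Type} [DecidableEq K] {n : ℕ} {P : OmegaPMA L M}
    {ia : A → M} {E : PExp A L K n} {γ : K → M} {ν : Fin n → M} {v : M}
    (h : PInterp P ia E γ ν v) : AInterp P (E.toAExp P ia) γ ν v := by
  induction h with
  | eps γ ν => exact .const γ ν _
  | var γ ν z => exact .var γ ν z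
  | seq act _ ih => exact .seq _ ih
  | call i _ ih => exact .call i ih
  | cond φ _ _ ih₁ ih₂ => exact .cond φ ih₁ ih₂
  | prob p _ _ ih₁ ih₂ => exact .prob p ih₁ ih₂
  | ndet _ _ ih₁ ih₂ => exact .ndet ih₁ ih₂
  | concat z _ _ ih₂ ih₁ => exact .concat z ih₂ ih₁
  | mu z g _ hfix hleast ih => exact .mu z g ih hfix hleast

theorem PInterp.of_toAExp {A L M K : Type} [DecidableEq K] {n : ℕ} {P : OmegaPMA L M}
    {ia : A → M} {E : PExp A L K n} {γ : K → M} {ν : Fin n → M} {v : M}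
    (h : AInterp P (E.toAExp P ia) γ ν v) : PInterp P ia E γ ν v := by
  induction E generalizing γ v with
  | eps => cases h; exact .eps γ ν
  | var z => cases h; exact .var γ ν z
  | seq act E ih => cases h with | seq _ h => exact .seq act (ih h)
  | call i E ih => cases h with | call _ h => exact .call i (ih h)
  | cond φ E₁ E₂ ih₁ ih₂ => cases h with | cond _ h₁ h₂ => exact .cond φ (ih₁ h₁) (ih₂ h₂)
  | prob p E₁ E₂ ih₁ ih₂ => cases h with | prob _ h₁ h₂ => exact .prob p (ih₁ h₁) (ih₂ h₂)
  | ndet E₁ E₂ ih₁ ih₂ => cases h with | ndet h₁ h₂ => exact .ndet (ih₁ h₁) (ih₂ h₂)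
  | concat z E₁ E₂ ih₁ ih₂ =>
    cases h with | concat _ h₂ h₁ => exact .concat z (ih₂ h₂) (ih₁ h₁)
  | mu z E ih =>
    cases h with | mu _ g h hfix hleast => exact .mu z g (fun θ => ih (h θ)) hfix hleast

/-- For any regular infinite-tree expression `E` over the program alphabet, there is an
algebraic regular infinite-tree expression `E'` such that for every valuation `γ` and
every procedure-summary vector `ν`, the interpretations agree:
`𝓢𝓜_γ⟦E⟧(ν) = M_γ⟦E'⟧(ν)`. -/
theorem exists_algebraic_expression {A L M K : Type} [DecidableEq K] {n : ℕ}
    (P : OmegaPMA L M) (ia : A → M) (E : PExp A L K n) :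
    ∃ E' : AExp L M K n, ∀ (γ : K → M) (ν : Fin n → M) (v : M),
      PInterp P ia E γ ν v ↔ AInterp P E' γ ν v := by
  exact ⟨E.toAExp P ia, fun _ _ _ => ⟨PInterp.toAExp, PInterp.of_toAExp⟩⟩
end
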